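/- Let H be a graph with distinguished ordered tuples of vertices U = (u_1,…,u_x) and V = (v_1,…,v_y) with |U ∩ V| = r, such that every vertex of H outside U ∪ V has degree at least one. Let t = |V(H)|, let z = |V(H) \ (U ∪ V)|, let q be the minimum size of a vertex separator of U and V in H (any such separator contains U ∩ V), and set t' = t − r and q' = q − r. (1) If q' + z > 0, then for all ε ∈ (0,1), the probability that ‖R_H‖ ≥ 2·(t')^{t'}·(e·(t'+z)·(ln(8·n^{q'+r}/ε)/(2(q'+z)) + 1))^{q'+z} · n^{(t'−q')/2} is at most ε. (2) If q' = z = 0, then ‖R_H‖ ≤ n^{t/2} for every g ∈ Ω. -/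

import Mathlib

noncomputable def opNorm {α β : Type*} [Fintype α] [Fintype β] [DecidableEq β]
    (M : Matrix α β ℝ) : ℝ :=
  ‖LinearMap.toContinuousLinearMap (Matrix.toEuclideanLin M)‖

def sgn (b : Bool) : ℝ := if b then 1 else -1

noncomputable def Pr {n : ℕ} (P : (Sym2 (Fin n) → Bool) → Prop) : ℝ := by
  classical
  exact ((Finset.univ.filter P).card : ℝ) / (Fintype.card (Sym2 (Fin n) → Bool))

noncomputable def Ex {n : ℕ} (f : (Sym2 (Fin n) → Bool) → ℝ) : ℝ :=
  (∑ g : Sym2 (Fin n) → Bool, f g) / (Fintype.card (Sym2 (Fin n) → Bool))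

noncomputable def Rmat {n : ℕ} (g : Sym2 (Fin n) → Bool) : Matrix (Fin n) (Fin n) ℝ :=
  Matrix.of fun i j => if i = j then 0 else sgn (g s(i, j))

def cyc {m : ℕ} (j : Fin m) : Fin m := ⟨((j : ℕ) + 1) % m, Nat.mod_lt _ j.pos⟩

abbrev SubsetsCard (n x : ℕ) := {A : Finset (Fin n) // A.card = x}

def tup {n x : ℕ} (A : SubsetsCard n x) (i : Fin x) : Fin n :=
  (A.1.orderIsoOfFin A.2 i : Fin n)

noncomputable def RH {n x y : ℕ} (E : Finset (Fin x × Fin y)) (g : Sym2 (Fin n) → Bool) :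
    Matrix (SubsetsCard n x) (SubsetsCard n y) ℝ :=
  Matrix.of fun A B =>
    if Disjoint A.1 B.1 then ∏ e ∈ E, sgn (g s(tup A e.1, tup B e.2)) else 0

def IsVertexCover {x y : ℕ} (E : Finset (Fin x × Fin y)) (S : Finset (Fin x ⊕ Fin y)) : Prop :=
  ∀ e ∈ E, Sum.inl e.1 ∈ S ∨ Sum.inr e.2 ∈ S

open Classical in
noncomputable def piMap {n x y z : ℕ} [NeZero n] {VT : Type*}
    (U : Fin x ↪ VT) (V : Fin y ↪ VT) (W : Fin z ↪ VT)
    (A : SubsetsCard n x) (B : SubsetsCard n y) (C : Fin z → Fin n) : VT → Fin n :=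
  fun v =>
    if h : ∃ i, U i = v then tup A h.choose
    else if h' : ∃ j, V j = v then tup B h'.choose
    else if h'' : ∃ m, W m = v then C h''.choose
    else 0

noncomputable def RH19 {n x y z : ℕ} [NeZero n] {VT : Type*} [Fintype VT] [DecidableEq VT]
    (U : Fin x ↪ VT) (V : Fin y ↪ VT) (W : Fin z ↪ VT)
    (H : SimpleGraph VT) [DecidableRel H.Adj] (g : Sym2 (Fin n) → Bool) :
    Matrix (SubsetsCard n x) (SubsetsCard n y) ℝ :=
  Matrix.of fun A B =>
    if ∀ i j, tup A i = tup B j ↔ U i = V j then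
      ∑ C : Fin z ↪ Fin n,
        if ∀ m, C m ∉ A.1 ∧ C m ∉ B.1 then
          ∏ e ∈ H.edgeFinset, sgn (g (Sym2.map (piMap U V W A B ⇑C) e))
        else 0
    else 0

lemma opNorm_nonneg {α β : Type*} [Fintype α] [Fintype β] [DecidableEq β]
    (M : Matrix α β ℝ) : 0 ≤ opNorm M := norm_nonneg _

open scoped Matrix.Norms.L2Operator in
/-- The largest eigenvalue of a positive semidefinite matrix is its norm, so its powers are bounded
by the trace of the corresponding power of the matrix. -/
lemma norm_pow_le_trace_pow {α : Type*} [Fintype α] [DecidableEq α]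
    {S : Matrix α α ℝ} (hS : S.PosSemidef) {k : ℕ} (hk : k ≠ 0) :
    ‖S‖ ^ k ≤ (S ^ k).trace := by
  have hH := hS.isHermitian
  have hnn : ∀ i, 0 ≤ hH.eigenvalues i := hS.eigenvalues_nonneg
  have hspec := hH.spectral_theorem
  rw [Unitary.conjStarAlgAut_apply] at hspec
  have htr : (S ^ k).trace = ∑ i, hH.eigenvalues i ^ k := by
    conv_lhs => rw [hH.spectral_theorem]
    rw [← map_pow, Unitary.conjStarAlgAut_apply, Matrix.trace_mul_comm, ← mul_assoc]
    simp [Matrix.diagonal_pow, Matrix.trace_diagonal]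
  have hnorm : ‖S‖ ≤ ‖hH.eigenvalues‖ := by
    conv_lhs => rw [hspec]
    rw [← Unitary.coe_star, CStarRing.norm_mul_coe_unitary, CStarRing.norm_coe_unitary_mul,
      Matrix.l2_opNorm_diagonal]
    exact le_of_eq rfl
  rw [htr]
  refine (pow_le_pow_left₀ (norm_nonneg _) hnorm k).trans ?_
  rcases isEmpty_or_nonempty α with hα | hα
  · have : ‖hH.eigenvalues‖ = 0 := by
      rw [norm_eq_zero]; exact Subsingleton.elim _ _
    simp [this, hk]
  · obtain ⟨i, hi⟩ := Finite.exists_max hH.eigenvalues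
    have : ‖hH.eigenvalues‖ ≤ hH.eigenvalues i := by
      refine (pi_norm_le_iff_of_nonneg (hnn i)).2 fun j => ?_
      rw [Real.norm_of_nonneg (hnn j)]
      exact hi j
    refine (pow_le_pow_left₀ (norm_nonneg _) this k).trans ?_
    exact Finset.single_le_sum (f := fun i => hH.eigenvalues i ^ k)
      (fun j _ => pow_nonneg (hnn j) k) (Finset.mem_univ i)

open scoped Matrix.Norms.L2Operator in
lemma opNorm_pow_le_trace {α β : Type*} [Fintype α] [Fintype β] [DecidableEq α] [DecidableEq β]
    (M : Matrix α β ℝ) {k : ℕ} (hk : k ≠ 0) :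
    opNorm M ^ (2 * k) ≤ ((M * M.transpose) ^ k).trace := by
  have h := norm_pow_le_trace_pow (Matrix.posSemidef_self_mul_conjTranspose M) hk
  have h2 := Matrix.l2_opNorm_conjTranspose_mul_self M.conjTranspose
  rw [Matrix.conjTranspose_conjTranspose, Matrix.l2_opNorm_conjTranspose] at h2
  rw [h2, ← pow_two, ← pow_mul] at h
  rwa [Matrix.conjTranspose_eq_transpose_of_trivial] at h

lemma matrix_pow_apply_eq_sum {ι : Type*} [Fintype ι] [DecidableEq ι] (M : Matrix ι ι ℝ) (k : ℕ) :
    ∀ a b : ι, (M ^ (k + 1)) a b = ∑ w : Fin k → ι, ∏ i : Fin (k + 1),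
      M ((Fin.cons a w : Fin (k + 1) → ι) i) ((Fin.snoc w b : Fin (k + 1) → ι) i) := by
  induction k with
  | zero => intro a b; simp [Fin.snoc]
  | succ k ih =>
    intro a b
    rw [pow_succ', Matrix.mul_apply]
    rw [← (Fin.consEquiv fun _ : Fin (k + 1) => ι).sum_comp, Fintype.sum_prod_type]
    refine Finset.sum_congr rfl fun c _ => ?_
    rw [ih, Finset.mul_sum]
    refine Finset.sum_congr rfl fun w _ => ?_
    change _ = ∏ i, M ((Fin.cons a (Fin.cons c w : Fin (k + 1) → ι) : Fin (k + 2) → ι) i)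
      ((Fin.snoc (Fin.cons c w : Fin (k + 1) → ι) b : Fin (k + 2) → ι) i)
    rw [← Fin.cons_snoc_eq_snoc_cons]
    conv_rhs => rw [Fin.prod_univ_succ]
    simp only [Fin.cons_zero, Fin.cons_succ]

/-- The trace of a power is a sum over closed walks. -/
lemma matrix_trace_pow_eq_sum {ι : Type*} [Fintype ι] [DecidableEq ι] (M : Matrix ι ι ℝ) (k : ℕ) :
    (M ^ (k + 1)).trace = ∑ w : Fin (k + 1) → ι, ∏ i, M (w i) (w (i + 1)) := by
  rw [← (Fin.consEquiv fun _ : Fin (k + 1) => ι).sum_comp, Fintype.sum_prod_type, Matrix.trace]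
  refine Finset.sum_congr rfl fun a _ => ?_
  rw [Matrix.diag_apply, matrix_pow_apply_eq_sum]
  refine Finset.sum_congr rfl fun w _ => Finset.prod_congr rfl fun i _ => ?_
  simp only [Fin.consEquiv_apply]
  congr 1
  refine Fin.lastCases ?_ (fun j => ?_) i
  · simp
  · simp [Fin.coeSucc_eq_succ]

lemma matrix_mul_pow_succ {α ι : Type*} [Fintype α] [Fintype ι] [DecidableEq α] [DecidableEq ι]
    (X : Matrix α ι ℝ) (Y : Matrix ι α ℝ) (k : ℕ) :
    (X * Y) ^ (k + 1) = X * (Y * X) ^ k * Y := by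
  induction k with
  | zero => simp
  | succ k ih => rw [pow_succ, ih, pow_succ]; simp only [Matrix.mul_assoc]

lemma trace_mul_pow_comm {α ι : Type*} [Fintype α] [Fintype ι] [DecidableEq α] [DecidableEq ι]
    (X : Matrix α ι ℝ) (Y : Matrix ι α ℝ) (k : ℕ) :
    ((X * Y) ^ (k + 1)).trace = ((Y * X) ^ (k + 1)).trace := by
  rw [matrix_mul_pow_succ, Matrix.mul_assoc, Matrix.trace_mul_comm, Matrix.mul_assoc, ← pow_succ]

/-- Expansion of the trace moment of `Pᵀ * diagonal χ * Q` over closed alternating sequences. -/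
lemma trace_moment_eq_sum {α β ι : Type*} [Fintype α] [Fintype β] [Fintype ι]
    [DecidableEq α] [DecidableEq ι] (P : Matrix ι α ℝ) (Q : Matrix ι β ℝ)
    (χ : ι → ℝ) (k : ℕ) :
    (((P.transpose * Matrix.diagonal χ * Q) *
        (P.transpose * Matrix.diagonal χ * Q).transpose) ^ (k + 1)).trace =
      ∑ φ : Fin (k + 1) → ι, ∑ ψ : Fin (k + 1) → ι,
        (∏ i, (Q * Q.transpose) (φ i) (ψ i) * (P * P.transpose) (ψ i) (φ (i + 1))) *
          ∏ i, χ (φ i) * χ (ψ i) := by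
  have h : (P.transpose * Matrix.diagonal χ * Q) * (P.transpose * Matrix.diagonal χ * Q).transpose
      = P.transpose *
        (Matrix.diagonal χ * (Q * Q.transpose) * Matrix.diagonal χ * P) := by
    simp only [Matrix.transpose_mul, Matrix.diagonal_transpose, Matrix.transpose_transpose,
      Matrix.mul_assoc]
  rw [h, trace_mul_pow_comm, matrix_trace_pow_eq_sum]
  refine Finset.sum_congr rfl fun φ _ => ?_
  have hentry : ∀ a b, (Matrix.diagonal χ * (Q * Q.transpose) * Matrix.diagonal χ * P *
      P.transpose) a b = ∑ c, ((Q * Q.transpose) a c * (P * P.transpose) c b) * (χ a * χ c) := by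
    intro a b
    rw [Matrix.mul_assoc, Matrix.mul_apply]
    refine Finset.sum_congr rfl fun c _ => ?_
    rw [Matrix.mul_diagonal, Matrix.diagonal_mul]
    ring
  simp only [hentry]
  rw [Finset.prod_univ_sum, Fintype.piFinset_univ]
  refine Finset.sum_congr rfl fun ψ _ => ?_
  rw [Finset.prod_mul_distrib]

section Separators

variable {VT : Type*} {H : SimpleGraph VT}

lemma exists_crossing_of_walk {D m : VT → ℕ} {θ : ℕ}
    (hadj : ∀ a b, H.Adj a b → D b ≤ D a + m b) {a b : VT} (p : H.Walk a b)
    (ha : D a < θ + m a) (hb : θ ≤ D b) :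
    ∃ s ∈ p.support, θ ≤ D s ∧ D s < θ + m s := by
  induction p with
  | nil => exact ⟨_, by simp, hb, ha⟩
  | @cons a c b h p ih =>
    by_cases hθ : θ ≤ D a
    · exact ⟨a, by simp, hθ, ha⟩
    · have := hadj a c h
      obtain ⟨s, hs, h'⟩ := ih (by omega) hb
      exact ⟨s, by simp [hs], h'⟩

/-- Weak form of Menger's theorem: a vertex weight for which every walk from `U` to `V` has weight
at least `K` has total weight at least `K` times the size of a smallest separator. -/
lemma mul_separator_le_sum_weight [Fintype VT] [DecidableEq VT] {x y : ℕ}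
    (U : Fin x → VT) (V : Fin y → VT) {q K : ℕ}
    (hq : ∀ S : Finset VT,
      (∀ (i : Fin x) (j : Fin y) (p : H.Walk (U i) (V j)), ∃ s ∈ S, s ∈ p.support) → q ≤ S.card)
    (m : VT → ℕ)
    (hm : ∀ (i : Fin x) (j : Fin y) (p : H.Walk (U i) (V j)), K ≤ (p.support.map m).sum) :
    K * q ≤ ∑ v, m v := by
  classical
  let A : VT → Set ℕ := fun v => {s | s = K ∨ ∃ i, ∃ p : H.Walk (U i) v, s = (p.support.map m).sum}
  let D : VT → ℕ := fun v => sInf (A v)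
  have hmem : ∀ v, D v ∈ A v := fun v => Nat.sInf_mem ⟨K, Or.inl rfl⟩
  have hle : ∀ v s, s ∈ A v → D v ≤ s := fun v s hs => Nat.sInf_le hs
  have hadj : ∀ a b, H.Adj a b → D b ≤ D a + m b := by
    intro a b hab
    rcases hmem a with h | ⟨i, p, h⟩
    · have := hle b K (Or.inl rfl)
      omega
    · refine (hle b _ (Or.inr ⟨i, p.concat hab, rfl⟩)).trans (le_of_eq ?_)
      simp [h, SimpleGraph.Walk.support_concat]
  have hU : ∀ i, D (U i) ≤ m (U i) := fun i =>
    (hle _ _ (Or.inr ⟨i, SimpleGraph.Walk.nil, rfl⟩)).trans (by simp)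
  have hV : ∀ (i : Fin x) (j : Fin y), K ≤ D (V j) := by
    intro _ j
    rcases hmem (V j) with h | ⟨i, p, h⟩
    · exact h.ge
    · exact h ▸ hm i j p
  have hS : ∀ θ ∈ Finset.Icc 1 K, q ≤ (Finset.univ.filter fun v => θ ≤ D v ∧ D v < θ + m v).card := by
    intro θ hθ
    rw [Finset.mem_Icc] at hθ
    refine hq _ fun i j p => ?_
    obtain ⟨s, hs, h⟩ := exists_crossing_of_walk (θ := θ) hadj p
      (by have := hU i; omega) (hθ.2.trans (hV i j))
    exact ⟨s, by simpa using h, hs⟩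
  calc K * q = ∑ θ ∈ Finset.Icc 1 K, q := by simp
    _ ≤ ∑ θ ∈ Finset.Icc 1 K, (Finset.univ.filter fun v => θ ≤ D v ∧ D v < θ + m v).card :=
      Finset.sum_le_sum hS
    _ = ∑ v, ((Finset.Icc 1 K).filter fun θ => θ ≤ D v ∧ D v < θ + m v).card := by
      simp only [Finset.card_filter]
      exact Finset.sum_comm
    _ ≤ ∑ v, m v := by
      refine Finset.sum_le_sum fun v _ => ?_
      calc _ ≤ (Finset.Ioc (D v - m v) (D v)).card := by
            refine Finset.card_le_card fun θ hθ => ?_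
            simp only [Finset.mem_filter, Finset.mem_Icc, Finset.mem_Ioc] at hθ ⊢
            omega
        _ ≤ m v := by rw [Nat.card_Ioc]; omega

lemma sum_support_le_add_sum_darts (f : VT → ℕ) (h : VT → VT → ℕ)
    (hl : ∀ a b, f a ≤ h a b) (hr : ∀ a b, f b ≤ h a b) {a b : VT} (p : H.Walk a b) :
    (p.support.map f).sum ≤ f a + (p.darts.map fun d => h d.fst d.snd).sum ∧
      (p.support.map f).sum ≤ f b + (p.darts.map fun d => h d.fst d.snd).sum := by
  induction p with
  | nil => simp
  | @cons a c b hac p ih =>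
    have h1 := hl a c
    have h2 := hr a c
    simp only [SimpleGraph.Walk.support_cons, SimpleGraph.Walk.darts_cons, List.map_cons,
      List.sum_cons]
    omega

variable {α : Type*}

open Classical in
/-- The number of values taken by the maps in `T` along a walk exceeds the number of pairs of values
on the darts of the walk by at most one. -/
def WalkBound {a b : VT} (p : H.Walk a b) (T : Finset (VT → α)) : Prop :=
  (p.support.map fun w => (T.image fun f => f w).card).sum ≤
    (p.darts.map fun d => (T.image fun f => (f d.fst, f d.snd)).card).sum + 1

lemma walkBound_singleton {a b : VT} (p : H.Walk a b) (f : VT → α) : WalkBound p {f} := by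
  simp [WalkBound]

open Classical in
lemma WalkBound.insert_map {a b : VT} {p : H.Walk a b} {T : Finset (VT → α)} (hT : WalkBound p T)
    {f f' : VT → α} (hf' : f' ∈ T) (h : f a = f' a ∨ f b = f' b) : WalkBound p (insert f T) := by
  let nv : VT → ℕ := fun w => if f w ∈ T.image fun f => f w then 0 else 1
  let ne : VT → VT → ℕ := fun v w =>
    if (f v, f w) ∈ T.image fun f => (f v, f w) then 0 else 1
  have hl : ∀ v w, nv v ≤ ne v w := by
    intro v w
    simp only [nv, ne]
    split_ifs with h1 h2 <;> simp_all
    grind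
  have hr : ∀ v w, nv w ≤ ne v w := by
    intro v w
    simp only [nv, ne]
    split_ifs with h1 h2 <;> simp_all
    grind
  have hv : ∀ w, ((insert f T).image fun f => f w).card =
      (T.image fun f => f w).card + nv w := by
    intro w
    rw [Finset.image_insert, Finset.card_insert_eq_ite]
    simp only [nv]
    split_ifs <;> rfl
  have he : ∀ v w, ((insert f T).image fun f => (f v, f w)).card =
      (T.image fun f => (f v, f w)).card + ne v w := by
    intro v w
    rw [Finset.image_insert, Finset.card_insert_eq_ite]
    simp only [ne]
    split_ifs <;> rfl
  have hnew := sum_support_le_add_sum_darts nv ne hl hr p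
  have hzero : nv a = 0 ∨ nv b = 0 := by
    rcases h with h | h
    · left; simp only [nv]; rw [if_pos]; rw [h]; exact Finset.mem_image_of_mem _ hf'
    · right; simp only [nv]; rw [if_pos]; rw [h]; exact Finset.mem_image_of_mem _ hf'
  unfold WalkBound at hT ⊢
  simp only [hv, he, List.sum_map_add]
  omega

open Classical in
lemma walkBound_closed_sequence {a b : VT} (p : H.Walk a b) {k : ℕ} (φ ψ : Fin (k + 1) → VT → α)
    (hb : ∀ i, φ i b = ψ i b) (ha : ∀ i, ψ i a = φ (i + 1) a) :
    WalkBound p (Finset.univ.image φ ∪ Finset.univ.image ψ) := by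
  let T : Fin (k + 1) → Finset (VT → α) := fun i =>
    (Finset.univ.filter (· ≤ i)).image φ ∪ (Finset.univ.filter (· ≤ i)).image ψ
  have key : ∀ i, WalkBound p (T i) := by
    intro i
    induction i using Fin.induction with
    | zero =>
      have : T 0 = insert (ψ 0) {φ 0} := by
        ext f; simp [T]; tauto
      rw [this]
      exact (walkBound_singleton p _).insert_map (Finset.mem_singleton_self _) (Or.inr (hb 0).symm)
    | succ i ih =>
      have hle : ∀ j : Fin (k + 1), j ≤ i.succ ↔ j = i.succ ∨ j ≤ i.castSucc := by
        intro j
        simp only [Fin.le_def, Fin.ext_iff, Fin.val_succ, Fin.val_castSucc]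
        omega
      have : T i.succ = insert (ψ i.succ) (insert (φ i.succ) (T i.castSucc)) := by
        ext f
        simp only [T, Finset.mem_union, Finset.mem_image, Finset.mem_filter, Finset.mem_univ,
          true_and, Finset.mem_insert, hle]
        grind
      rw [this]
      refine WalkBound.insert_map (f' := φ i.succ) (WalkBound.insert_map (f' := ψ i.castSucc) ih ?_ ?_) ?_
        (Or.inr (hb _).symm)
      · simp only [T, Finset.mem_union, Finset.mem_image, Finset.mem_filter]
        exact Or.inr ⟨_, ⟨Finset.mem_univ _, le_rfl⟩, rfl⟩
      · left
        rw [ha, Fin.coeSucc_eq_succ]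
      · exact Finset.mem_insert_self _ _
  have := key (Fin.last k)
  simpa [T, Fin.le_last] using this

end Separators

/-- The number of functions with few values. -/
lemma card_filter_image_le {X Y : Type*} [Fintype X] [DecidableEq X] [Fintype Y] [DecidableEq Y]
    {d m : ℕ} (hX : Fintype.card X = d + m) :
    (Finset.univ.filter fun F : X → Y => (Finset.univ.image F).card ≤ d).card ≤
      (d + m) ^ (2 * m) * Fintype.card Y ^ d := by
  classical
  let B : (Fin m → X) × (Fin m → X) → Finset (X → Y) := fun c =>
    Finset.univ.filter fun F => Function.Injective c.1 ∧
      (∀ i j, c.2 i ≠ c.1 j) ∧ ∀ i, F (c.1 i) = F (c.2 i)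
  have hsub : (Finset.univ.filter fun F : X → Y => (Finset.univ.image F).card ≤ d) ⊆
      Finset.univ.biUnion B := by
    intro F hF
    rw [Finset.mem_filter] at hF
    obtain ⟨S, hS, hSi⟩ : ∃ S : Finset X, S.image F = Finset.univ.image F ∧
        S.card = (Finset.univ.image F).card := by
      obtain ⟨S, -, hS2, hS3⟩ := Finset.exists_subset_injOn_image_eq_of_surjOn
        (f := F) Set.univ (Finset.univ.image F) (by intro b hb; simpa using hb)
      exact ⟨S, hS3, by rw [← hS3, Finset.card_image_of_injOn hS2]⟩
    obtain ⟨T, hST, hT⟩ := Finset.exists_superset_card_eq (s := S) (n := d)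
      (hSi ▸ hF.2) (by omega)
    have hc : Tᶜ.card = m := by rw [Finset.card_compl]; omega
    have hex : ∀ a : X, ∃ b ∈ T, F a = F b := by
      intro a
      have : F a ∈ S.image F := hS ▸ Finset.mem_image_of_mem _ (Finset.mem_univ _)
      obtain ⟨b, hb, h⟩ := Finset.mem_image.1 this
      exact ⟨b, hST hb, h.symm⟩
    choose s hsT hs using hex
    let e := Tᶜ.equivFinOfCardEq hc
    refine Finset.mem_biUnion.2 ⟨(fun i => (e.symm i : X), fun i => s (e.symm i)),
      Finset.mem_univ _, ?_⟩
    simp only [B, Finset.mem_filter, Finset.mem_univ, true_and]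
    refine ⟨Subtype.val_injective.comp e.symm.injective, fun i j h => ?_, fun i => hs _⟩
    exact Finset.mem_compl.1 (e.symm j).2 (h ▸ hsT _)
  have hB : ∀ c, (B c).card ≤ Fintype.card Y ^ d := by
    intro c
    by_cases hc : Function.Injective c.1
    · let T := (Finset.univ.image c.1)ᶜ
      have hT : Fintype.card T = d := by
        rw [Fintype.card_coe, Finset.card_compl, Finset.card_image_of_injective _ hc]
        simp [hX]
      calc (B c).card ≤ (Finset.univ : Finset (T → Y)).card := by
            refine Finset.card_le_card_of_injOn (fun F a => F a) 
              (fun _ _ => Finset.mem_coe.2 (Finset.mem_univ _)) ?_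
            intro F hF G hG h
            simp only [B, Finset.coe_filter, Finset.mem_univ, true_and, Set.mem_ofPred_eq] at hF hG
            have hout : ∀ a, (∀ j, a ≠ c.1 j) → F a = G a := fun a ha =>
              congrFun h ⟨a, by simp [T]; exact fun j hj => ha j hj.symm⟩
            funext a
            by_cases ha : ∃ j, a = c.1 j
            · obtain ⟨j, rfl⟩ := ha
              rw [hF.2.2, hG.2.2, hout _ (hF.2.1 j)]
            · exact hout a (not_exists.1 ha)
        _ = _ := by rw [Finset.card_univ, Fintype.card_fun, hT]
    · simp [B, hc]
  calc _ ≤ (Finset.univ.biUnion B).card := Finset.card_le_card hsub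
    _ ≤ ∑ c, (B c).card := Finset.card_biUnion_le
    _ ≤ ∑ _c : (Fin m → X) × (Fin m → X), Fintype.card Y ^ d := Finset.sum_le_sum fun c _ => hB c
    _ = _ := by simp [hX, two_mul, pow_add]

lemma sgn_not (b : Bool) : sgn (!b) = -sgn b := by cases b <;> simp [sgn]

lemma abs_sgn (b : Bool) : |sgn b| = 1 := by cases b <;> simp [sgn]

/-- A monomial in independent signs that contains some sign an odd number of times has mean zero. -/
lemma sum_prod_sgn_eq_zero {E ι : Type*} [Fintype E] [DecidableEq E] (s : Finset ι) (p : ι → E)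
    {e : E} (he : Odd (s.filter fun a => p a = e).card) :
    ∑ g : E → Bool, ∏ a ∈ s, sgn (g (p a)) = 0 := by
  let σ : Equiv.Perm (E → Bool) :=
    (show Function.Involutive fun g : E → Bool => Function.update g e (!g e) by
      intro g; simp).toPerm
  have hσ : ∀ g : E → Bool, ∏ a ∈ s, sgn (σ g (p a)) = -∏ a ∈ s, sgn (g (p a)) := by
    intro g
    have : ∀ a, sgn (σ g (p a)) = (if p a = e then -1 else 1) * sgn (g (p a)) := by
      intro a
      change sgn (Function.update g e (!g e) (p a)) = _
      by_cases h : p a = e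
      · simp [h, sgn_not]
      · simp [h]
    simp only [this]
    rw [Finset.prod_mul_distrib, Finset.prod_ite]
    simp [he.neg_one_pow]
  have h := Equiv.sum_comp σ fun g => ∏ a ∈ s, sgn (g (p a))
  simp only [hσ, Finset.sum_neg_distrib] at h
  linarith

lemma sum_prod_sgn_le {E ι : Type*} [Fintype E] [DecidableEq E] (s : Finset ι) (p : ι → E) :
    ∑ g : E → Bool, ∏ a ∈ s, sgn (g (p a)) ≤ Fintype.card (E → Bool) := by
  calc _ ≤ ∑ _g : E → Bool, (1 : ℝ) := by
        refine Finset.sum_le_sum fun g _ => (le_abs_self _).trans (le_of_eq ?_)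
        simp [Finset.abs_prod, abs_sgn]
    _ = _ := by simp

/-- The number of colourings of `Y` by `T` that invert a given injection `T → Y`. -/
lemma card_inverting_colourings {T Y : Type*} [Fintype T] [DecidableEq T] [Fintype Y]
    [DecidableEq Y] (φ : T → Y) (hφ : Function.Injective φ) :
    Fintype.card T ^ Fintype.card T *
        (Finset.univ.filter fun c : Y → T => ∀ v, c (φ v) = v).card =
      Fintype.card (Y → T) := by
  classical
  have h : (Finset.univ.filter fun c : Y → T => ∀ v, c (φ v) = v) =
      Fintype.piFinset fun a => Finset.univ.filter fun u => ∀ v, φ v = a → u = v := by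
    ext c
    simp only [Finset.mem_filter, Finset.mem_univ, true_and, Fintype.mem_piFinset]
    exact ⟨fun h a v hv => hv ▸ h v, fun h v => h _ v rfl⟩
  have h1 : ∀ a, (Finset.univ.filter fun u => ∀ v, φ v = a → u = v).card =
      if a ∈ Finset.univ.image φ then 1 else Fintype.card T := by
    intro a
    split_ifs with ha
    · obtain ⟨v, -, rfl⟩ := Finset.mem_image.1 ha
      rw [Finset.card_eq_one]
      refine ⟨v, ?_⟩
      ext u
      simp only [Finset.mem_filter, Finset.mem_univ, true_and, Finset.mem_singleton]
      exact ⟨fun h => h v rfl, fun h w hw => h.trans (hφ hw).symm⟩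
    · rw [Finset.filter_true_of_mem, Finset.card_univ]
      intro u _ v hv
      exact (ha (hv ▸ Finset.mem_image_of_mem _ (Finset.mem_univ _))).elim
  rw [h, Fintype.card_piFinset, Finset.prod_congr rfl fun a _ => h1 a, Finset.prod_ite]
  have hcard : (Finset.univ.filter fun a => a ∉ Finset.univ.image φ).card =
      Fintype.card Y - Fintype.card T := by
    rw [Finset.filter_not, Finset.card_sdiff_of_subset (Finset.filter_subset _ _)]
    simp [Finset.card_image_of_injective _ hφ]
  rw [Finset.prod_const_one, Finset.prod_const, one_mul, hcard, ← pow_add, Fintype.card_fun]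
  have := Fintype.card_le_of_injective φ hφ
  congr 1
  omega

section GraphMatrix

variable {n x y z : ℕ} {VT : Type*}

lemma tup_injective {n x : ℕ} (A : SubsetsCard n x) : Function.Injective (tup A) := fun _ _ h =>
  (A.1.orderIsoOfFin A.2).injective (Subtype.ext h)

lemma tup_mem {n x : ℕ} (A : SubsetsCard n x) (i : Fin x) : tup A i ∈ A.1 :=
  (A.1.orderIsoOfFin A.2 i).2

lemma exists_tup_eq {n x : ℕ} (A : SubsetsCard n x) {a : Fin n} (ha : a ∈ A.1) :
    ∃ i, tup A i = a :=
  ⟨(A.1.orderIsoOfFin A.2).symm ⟨a, ha⟩, by simp [tup]⟩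

lemma eq_of_tup_eq {n x : ℕ} {A B : SubsetsCard n x} (h : ∀ i, tup A i = tup B i) : A = B := by
  refine Subtype.ext (Finset.eq_of_subset_of_card_le (fun a ha => ?_) (by rw [A.2, B.2]))
  obtain ⟨i, rfl⟩ := exists_tup_eq A ha
  exact h i ▸ tup_mem B i

/-- Incidence between embeddings of the vertices of `H` and the sets they map the tuple `U` to. -/
def incidence (n : ℕ) (U : Fin x ↪ VT) : Matrix (VT ↪ Fin n) (SubsetsCard n x) ℝ :=
  Matrix.of fun φ A => if ∀ i, φ (U i) = tup A i then 1 else 0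

lemma incidence_gram_eq_zero (U : Fin x ↪ VT) {φ ψ : VT ↪ Fin n}
    (h : ¬∀ i, φ (U i) = ψ (U i)) :
    (incidence n U * (incidence n U).transpose) φ ψ = 0 := by
  rw [Matrix.mul_apply]
  refine Finset.sum_eq_zero fun A _ => ?_
  simp only [incidence, Matrix.transpose_apply, Matrix.of_apply]
  split_ifs with h1 h2
  · exact (h fun i => (h1 i).trans (h2 i).symm).elim
  all_goals simp

lemma incidence_gram_nonneg (U : Fin x ↪ VT) (φ ψ : VT ↪ Fin n) :
    0 ≤ (incidence n U * (incidence n U).transpose) φ ψ := by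
  rw [Matrix.mul_apply]
  refine Finset.sum_nonneg fun A _ => ?_
  simp only [incidence, Matrix.transpose_apply, Matrix.of_apply]
  split_ifs <;> simp

lemma incidence_gram_le_one (U : Fin x ↪ VT) (φ ψ : VT ↪ Fin n) :
    (incidence n U * (incidence n U).transpose) φ ψ ≤ 1 := by
  classical
  rw [Matrix.mul_apply]
  calc _ ≤ ∑ A : SubsetsCard n x, if ∀ i, φ (U i) = tup A i then (1 : ℝ) else 0 := by
        refine Finset.sum_le_sum fun A _ => ?_
        simp only [incidence, Matrix.transpose_apply, Matrix.of_apply]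
        split_ifs <;> simp
    _ = ((Finset.univ.filter fun A : SubsetsCard n x => ∀ i, φ (U i) = tup A i).card : ℝ) := by
        simp
    _ ≤ 1 := by
        rw [Nat.cast_le_one, Finset.card_le_one]
        intro A hA B hB
        simp only [Finset.mem_filter, Finset.mem_univ, true_and] at hA hB
        exact eq_of_tup_eq fun i => (hA i).symm.trans (hB i)

/-- The product of the signs of the images of the edges of `H`. -/
noncomputable def edgeSign [Fintype VT] [DecidableEq VT] (H : SimpleGraph VT) [DecidableRel H.Adj]
    (g : Sym2 (Fin n) → Bool) (φ : VT ↪ Fin n) : ℝ :=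
  ∏ e ∈ H.edgeFinset, sgn (g (Sym2.map φ e))

lemma piMap_eq [NeZero n] {U : Fin x ↪ VT} {V : Fin y ↪ VT} {W : Fin z ↪ VT}
    (hcover : ∀ v : VT, (∃ i, U i = v) ∨ (∃ j, V j = v) ∨ (∃ m, W m = v))
    {A : SubsetsCard n x} {B : SubsetsCard n y} {φ : VT → Fin n}
    (hA : ∀ i, φ (U i) = tup A i) (hB : ∀ j, φ (V j) = tup B j) :
    piMap U V W A B (fun m => φ (W m)) = φ := by
  funext v
  unfold piMap
  split_ifs with h1 h2 h3
  · rw [← hA, h1.choose_spec]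
  · rw [← hB, h2.choose_spec]
  · exact congrArg φ h3.choose_spec
  · exact ((hcover v).elim h1 fun h => h.elim h2 h3).elim

lemma piMap_apply_left [NeZero n] {U : Fin x ↪ VT} {V : Fin y ↪ VT} {W : Fin z ↪ VT}
    {A : SubsetsCard n x} {B : SubsetsCard n y} {C : Fin z → Fin n} (i : Fin x) :
    piMap U V W A B C (U i) = tup A i := by
  have h : ∃ i', U i' = U i := ⟨i, rfl⟩
  unfold piMap
  rw [dif_pos h, U.injective h.choose_spec]

lemma piMap_apply_right [NeZero n] {U : Fin x ↪ VT} {V : Fin y ↪ VT} {W : Fin z ↪ VT}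
    {A : SubsetsCard n x} {B : SubsetsCard n y} {C : Fin z → Fin n}
    (hAB : ∀ i j, tup A i = tup B j ↔ U i = V j) (j : Fin y) :
    piMap U V W A B C (V j) = tup B j := by
  unfold piMap
  split_ifs with h1 h2
  · exact (hAB _ _).2 h1.choose_spec
  · rw [V.injective h2.choose_spec]
  · exact (h2 ⟨j, rfl⟩).elim
  · exact (h2 ⟨j, rfl⟩).elim

lemma piMap_apply_inner [NeZero n] {U : Fin x ↪ VT} {V : Fin y ↪ VT} {W : Fin z ↪ VT}
    (hWU : ∀ m i, W m ≠ U i) (hWV : ∀ m j, W m ≠ V j)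
    {A : SubsetsCard n x} {B : SubsetsCard n y} {C : Fin z → Fin n} (m : Fin z) :
    piMap U V W A B C (W m) = C m := by
  unfold piMap
  split_ifs with h1 h2 h3
  · exact (hWU m _ h1.choose_spec.symm).elim
  · exact (hWV m _ h2.choose_spec.symm).elim
  · rw [W.injective h3.choose_spec]
  · exact (h3 ⟨m, rfl⟩).elim

lemma piMap_injective [NeZero n] {U : Fin x ↪ VT} {V : Fin y ↪ VT} {W : Fin z ↪ VT}
    (hWU : ∀ m i, W m ≠ U i) (hWV : ∀ m j, W m ≠ V j)
    (hcover : ∀ v : VT, (∃ i, U i = v) ∨ (∃ j, V j = v) ∨ (∃ m, W m = v))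
    {A : SubsetsCard n x} {B : SubsetsCard n y} {C : Fin z ↪ Fin n}
    (hAB : ∀ i j, tup A i = tup B j ↔ U i = V j) (hC : ∀ m, C m ∉ A.1 ∧ C m ∉ B.1) :
    Function.Injective (piMap U V W A B C) := by
  have hCA : ∀ m i, C m ≠ tup A i := fun m i h => (hC m).1 (h ▸ tup_mem A i)
  have hCB : ∀ m j, C m ≠ tup B j := fun m j h => (hC m).2 (h ▸ tup_mem B j)
  intro v w h
  rcases hcover v with ⟨i, rfl⟩ | ⟨i, rfl⟩ | ⟨i, rfl⟩ <;>
  rcases hcover w with ⟨j, rfl⟩ | ⟨j, rfl⟩ | ⟨j, rfl⟩ <;>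
  simp only [piMap_apply_left, piMap_apply_right hAB, piMap_apply_inner hWU hWV] at h
  · rw [tup_injective A h]
  · exact (hAB i j).1 h
  · exact (hCA j i h.symm).elim
  · exact ((hAB j i).1 h.symm).symm
  · rw [tup_injective B h]
  · exact (hCB j i h.symm).elim
  · exact (hCA i j h).elim
  · exact (hCB i j h).elim
  · rw [C.injective h]

variable [Fintype VT] [DecidableEq VT]

lemma RH19_eq_mul [NeZero n] (U : Fin x ↪ VT) (V : Fin y ↪ VT) (W : Fin z ↪ VT)
    (hWU : ∀ m i, W m ≠ U i) (hWV : ∀ m j, W m ≠ V j)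
    (hcover : ∀ v : VT, (∃ i, U i = v) ∨ (∃ j, V j = v) ∨ (∃ m, W m = v))
    (H : SimpleGraph VT) [DecidableRel H.Adj] (g : Sym2 (Fin n) → Bool) :
    RH19 U V W H g =
      (incidence n U).transpose * Matrix.diagonal (edgeSign H g) * incidence n V := by
  ext A B
  have hR : ((incidence n U).transpose * Matrix.diagonal (edgeSign H g) * incidence n V) A B =
      ∑ φ : VT ↪ Fin n, if (∀ i, φ (U i) = tup A i) ∧ (∀ j, φ (V j) = tup B j) then
        edgeSign H g φ else 0 := by
    rw [Matrix.mul_apply]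
    refine Finset.sum_congr rfl fun φ _ => ?_
    rw [Matrix.mul_diagonal]
    simp only [incidence, Matrix.transpose_apply, Matrix.of_apply]
    split_ifs <;> simp_all
  rw [hR]
  simp only [RH19, Matrix.of_apply]
  split_ifs with hAB
  · rw [← Finset.sum_filter, ← Finset.sum_filter]
    symm
    refine Finset.sum_bij (fun φ _ => W.trans φ) ?_ ?_ ?_ ?_
    · intro φ hφ
      simp only [Finset.mem_filter, Finset.mem_univ, true_and] at hφ ⊢
      refine fun m => ⟨fun h => ?_, fun h => ?_⟩
      · obtain ⟨i, hi⟩ := exists_tup_eq A h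
        rw [← hφ.1] at hi
        exact hWU m i (φ.injective hi).symm
      · obtain ⟨i, hi⟩ := exists_tup_eq B h
        rw [← hφ.2] at hi
        exact hWV m i (φ.injective hi).symm
    · intro φ hφ ψ hψ h
      simp only [Finset.mem_filter, Finset.mem_univ, true_and] at hφ hψ
      have e1 := piMap_eq hcover hφ.1 hφ.2
      have e2 := piMap_eq hcover hψ.1 hψ.2
      have e3 : (fun m => φ (W m)) = fun m => ψ (W m) := by
        funext m; exact DFunLike.congr_fun h m
      rw [e3] at e1
      exact DFunLike.coe_injective (e1.symm.trans e2)
    · intro C hC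
      simp only [Finset.mem_filter, Finset.mem_univ, true_and] at hC
      refine ⟨⟨piMap U V W A B C, piMap_injective hWU hWV hcover hAB hC⟩, ?_, ?_⟩
      · simp only [Finset.mem_filter, Finset.mem_univ, true_and, Function.Embedding.coeFn_mk]
        exact ⟨piMap_apply_left, piMap_apply_right hAB⟩
      · ext m
        simp [piMap_apply_inner hWU hWV]
    · intro φ hφ
      simp only [Finset.mem_filter, Finset.mem_univ, true_and] at hφ
      have e1 := piMap_eq (W := W) hcover hφ.1 hφ.2
      unfold edgeSign
      rw [show (⇑(W.trans φ) : Fin z → Fin n) = fun m => φ (W m) from rfl, e1]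
  · symm
    refine Finset.sum_eq_zero fun φ _ => if_neg fun h => hAB fun i j => ?_
    rw [← h.1, ← h.2]
    exact φ.injective.eq_iff

end GraphMatrix

section GoodSequences

variable {n x y z k : ℕ} {VT : Type*} [Fintype VT] [DecidableEq VT]

/-- The common vertices of `U` and `V`. -/
def common (U : Fin x ↪ VT) (V : Fin y ↪ VT) : Finset VT :=
  Finset.univ.image ⇑U ∩ Finset.univ.image ⇑V

/-- The combined family of two sequences of embeddings. -/
def seqMap (φ ψ : Fin (k + 1) → VT ↪ Fin n) (a : Fin (k + 1) × Bool) : VT ↪ Fin n :=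
  if a.2 then ψ a.1 else φ a.1

/-- The closed alternating sequences of embeddings that contribute to the trace moment of the part
of the graph matrix respecting the colouring `c`. -/
structure GoodSeq (U : Fin x ↪ VT) (V : Fin y ↪ VT) (H : SimpleGraph VT) [DecidableRel H.Adj]
    (c : Fin n → {v // v ∉ common U V}) (φ ψ : Fin (k + 1) → VT ↪ Fin n) : Prop where
  colour_left : ∀ i v, c (φ i v.1) = v
  colour_right : ∀ i v, c (ψ i v.1) = v
  agree_right : ∀ i j, φ i (V j) = ψ i (V j)
  agree_left : ∀ i j, ψ i (U j) = φ (i + 1) (U j)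
  even_edges : ∀ s : Sym2 (Fin n), Even ((Finset.univ ×ˢ H.edgeFinset).filter
    fun a : (Fin (k + 1) × Bool) × Sym2 VT => Sym2.map (seqMap φ ψ a.1) a.2 = s).card

namespace GoodSeq

variable {U : Fin x ↪ VT} {V : Fin y ↪ VT} {H : SimpleGraph VT} [DecidableRel H.Adj]
  {c : Fin n → {v // v ∉ common U V}} {φ ψ : Fin (k + 1) → VT ↪ Fin n}

lemma apply_common (h : GoodSeq U V H c φ ψ) {v : VT} (hv : v ∈ common U V)
    (a : Fin (k + 1) × Bool) : seqMap φ ψ a v = φ 0 v := by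
  simp only [common, Finset.mem_inter, Finset.mem_image, Finset.mem_univ, true_and] at hv
  obtain ⟨⟨i, hi⟩, ⟨j, hj⟩⟩ := hv
  have hφψ : ∀ l, ψ l v = φ l v := fun l => by rw [← hj, h.agree_right]
  have hφ : ∀ l, φ l v = φ 0 v := by
    intro l
    induction l using Fin.induction with
    | zero => rfl
    | succ l ih =>
      have hl := h.agree_left l.castSucc i
      rw [Fin.coeSucc_eq_succ, hi, hφψ] at hl
      exact hl.symm.trans ih
  unfold seqMap
  split_ifs
  · rw [hφψ, hφ]
  · exact hφ _

lemma colour_seqMap (h : GoodSeq U V H c φ ψ) (a : Fin (k + 1) × Bool)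
    (v : {v // v ∉ common U V}) : c (seqMap φ ψ a v.1) = v := by
  unfold seqMap
  split_ifs
  · exact h.colour_right _ _
  · exact h.colour_left _ _

lemma separated (h : GoodSeq U V H c φ ψ) {a b : Fin (k + 1) × Bool} {v w : VT}
    (hvw : seqMap φ ψ a v = seqMap φ ψ b w) : v = w := by
  by_cases hv : v ∈ common U V
  · rw [h.apply_common hv, ← h.apply_common hv b] at hvw
    exact (seqMap φ ψ b).injective hvw
  by_cases hw : w ∈ common U V
  · rw [h.apply_common hw b, ← h.apply_common hw a] at hvw
    exact (seqMap φ ψ a).injective hvw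
  · have h1 := h.colour_seqMap a ⟨v, hv⟩
    have h2 := h.colour_seqMap b ⟨w, hw⟩
    simp only [hvw] at h1
    exact congrArg Subtype.val (h1.symm.trans h2)

lemma card_pair_le (h : GoodSeq U V H c φ ψ) {v w : VT} (hvw : H.Adj v w) :
    (Finset.univ.image fun a => (seqMap φ ψ a v, seqMap φ ψ a w)).card ≤ k + 1 := by
  have hfib : ∀ b ∈ Finset.univ.image fun a => (seqMap φ ψ a v, seqMap φ ψ a w),
      2 ≤ (Finset.univ.filter fun a => (seqMap φ ψ a v, seqMap φ ψ a w) = b).card := by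
    intro b hb
    obtain ⟨a, -, rfl⟩ := Finset.mem_image.1 hb
    let F := (Finset.univ ×ˢ H.edgeFinset).filter
      fun d : (Fin (k + 1) × Bool) × Sym2 VT =>
        Sym2.map (seqMap φ ψ d.1) d.2 = s(seqMap φ ψ a v, seqMap φ ψ a w)
    have hF : ∀ d ∈ F, d.2 = s(v, w) ∧
        (seqMap φ ψ d.1 v, seqMap φ ψ d.1 w) = (seqMap φ ψ a v, seqMap φ ψ a w) := by
      rintro ⟨d, e⟩ hd
      induction e using Sym2.ind with
      | _ v' w' =>
        have hd2 := (Finset.mem_filter.1 hd).2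
        simp only [Sym2.map_mk, Sym2.eq_iff] at hd2
        rcases hd2 with ⟨h1, h2⟩ | ⟨h1, h2⟩
        · obtain rfl := h.separated h1
          obtain rfl := h.separated h2
          exact ⟨rfl, Prod.ext h1 h2⟩
        · obtain rfl := h.separated h1
          obtain rfl := h.separated h2
          exact ⟨Sym2.eq_swap, Prod.ext h2 h1⟩
    have hpos : 0 < F.card := by
      refine Finset.card_pos.2 ⟨(a, s(v, w)), ?_⟩
      simp [F, hvw]
    have heven : Even F.card := h.even_edges _
    have h2 : 2 ≤ F.card := by
      obtain ⟨r, hr⟩ := heven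
      omega
    refine h2.trans (Finset.card_le_card_of_injOn Prod.fst ?_ ?_)
    · intro d hd
      simpa using (hF d hd).2
    · intro d hd d' hd' hdd
      exact Prod.ext hdd ((hF d hd).1.trans (hF d' hd').1.symm)
  have := Finset.mul_card_image_le_card (Finset.univ : Finset (Fin (k + 1) × Bool)) 2 hfib
  rw [Finset.card_univ, Fintype.card_prod, Fintype.card_fin, Fintype.card_bool] at this
  omega

lemma card_vertex_le (h : GoodSeq U V H c φ ψ)
    (hdeg : ∀ v, v ∉ Set.range U → v ∉ Set.range V → ∃ w, H.Adj v w) (v : VT) :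
    (Finset.univ.image fun a => seqMap φ ψ a v).card ≤ k + 1 := by
  by_cases hv : v ∈ Set.range U ∨ v ∈ Set.range V
  · calc _ ≤ (Finset.univ.image fun i => φ i v).card := by
          refine Finset.card_le_card fun b hb => ?_
          obtain ⟨⟨i, s⟩, -, rfl⟩ := Finset.mem_image.1 hb
          rw [Finset.mem_image]
          cases s with
          | false => exact ⟨i, Finset.mem_univ _, rfl⟩
          | true =>
            rcases hv with ⟨j, rfl⟩ | ⟨j, rfl⟩
            · exact ⟨i + 1, Finset.mem_univ _, (h.agree_left i j).symm⟩
            · exact ⟨i, Finset.mem_univ _, h.agree_right i j⟩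
      _ ≤ k + 1 := Finset.card_image_le.trans (by simp)
  · rw [not_or] at hv
    obtain ⟨w, hw⟩ := hdeg v hv.1 hv.2
    refine le_trans ?_ (h.card_pair_le hw)
    calc _ = ((Finset.univ.image fun a => (seqMap φ ψ a v, seqMap φ ψ a w)).image
          Prod.fst).card := by rw [Finset.image_image]; rfl
      _ ≤ _ := Finset.card_image_le

lemma le_sum_walk (h : GoodSeq U V H c φ ψ)
    (hdeg : ∀ v, v ∉ Set.range U → v ∉ Set.range V → ∃ w, H.Adj v w)
    (i : Fin x) (j : Fin y) (p : H.Walk (U i) (V j)) :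
    k ≤ (p.support.map fun v =>
      k + 1 - (Finset.univ.image fun a => seqMap φ ψ a v).card).sum := by
  classical
  have hb := walkBound_closed_sequence p (fun l => ⇑(φ l)) (fun l => ⇑(ψ l))
    (fun l => h.agree_right l j) (fun l => h.agree_left l i)
  unfold WalkBound at hb
  have hdarts : (p.darts.map fun d => (Finset.univ.image fun a =>
      (seqMap φ ψ a d.fst, seqMap φ ψ a d.snd)).card).sum ≤ p.length * (k + 1) := by
    refine (List.sum_le_card_nsmul _ (k + 1) ?_).trans (by simp)
    intro b hb
    obtain ⟨d, -, rfl⟩ := List.mem_map.1 hb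
    exact h.card_pair_le d.adj
  have hsum : (p.support.map fun v =>
        k + 1 - (Finset.univ.image fun a => seqMap φ ψ a v).card).sum +
      (p.support.map fun v => (Finset.univ.image fun a => seqMap φ ψ a v).card).sum =
        (p.length + 1) * (k + 1) := by
    rw [← List.sum_map_add]
    rw [List.map_congr_left fun v _ => Nat.sub_add_cancel (h.card_vertex_le hdeg v)]
    simp
  have : (p.length + 1) * (k + 1) = p.length * (k + 1) + (k + 1) := by ring
  have hle : (p.support.map fun v => (Finset.univ.image fun a => seqMap φ ψ a v).card).sum ≤
      p.length * (k + 1) + 1 := by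
    refine le_trans (le_of_eq ?_)
      (hb.trans (Nat.add_le_add_right (le_trans (le_of_eq ?_) hdarts) 1))
    all_goals
      congr 1
      refine List.map_congr_left fun v _ => ?_
      congr 1
      ext b
      simp only [Finset.mem_image, Finset.mem_union, Finset.mem_univ, true_and, Prod.exists,
        Bool.exists_bool, seqMap, or_and_right, exists_or, exists_exists_eq_and,
        Bool.false_eq_true, if_false, if_true]
  omega

/-- The total number of values of a good sequence outside the common vertices. -/
lemma sum_card_le (h : GoodSeq U V H c φ ψ)
    (hdeg : ∀ v, v ∉ Set.range U → v ∉ Set.range V → ∃ w, H.Adj v w) {q : ℕ}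
    (hq : ∀ S : Finset VT,
      (∀ (i : Fin x) (j : Fin y) (p : H.Walk (U i) (V j)), ∃ s ∈ S, s ∈ p.support) → q ≤ S.card) :
    ∑ v : {v // v ∉ common U V}, (Finset.univ.image fun a => seqMap φ ψ a v.1).card +
        k * (q - (common U V).card) ≤
      (k + 1) * Fintype.card {v // v ∉ common U V} := by
  have hw := mul_separator_le_sum_weight U V hq _ (h.le_sum_walk hdeg)
  rw [← Finset.sum_add_sum_compl (common U V)] at hw
  have hI : ∑ v ∈ common U V, (k + 1 - (Finset.univ.image fun a => seqMap φ ψ a v).card) =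
      k * (common U V).card := by
    rw [Finset.sum_congr rfl fun v hv => ?_, Finset.sum_const, smul_eq_mul, mul_comm]
    have : (Finset.univ.image fun a => seqMap φ ψ a v) = {φ 0 v} := by
      ext b
      simp [h.apply_common hv, eq_comm]
    rw [this]
    simp
  have hJ : ∑ v ∈ (common U V)ᶜ, (k + 1 - (Finset.univ.image fun a => seqMap φ ψ a v).card) =
      ∑ v : {v // v ∉ common U V},
        (k + 1 - (Finset.univ.image fun a => seqMap φ ψ a v.1).card) := by
    refine Finset.sum_subtype _ (fun v => by simp) _
  have hK : ∑ v : {v // v ∉ common U V},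
        (k + 1 - (Finset.univ.image fun a => seqMap φ ψ a v.1).card) +
      ∑ v : {v // v ∉ common U V}, (Finset.univ.image fun a => seqMap φ ψ a v.1).card =
        (k + 1) * Fintype.card {v // v ∉ common U V} := by
    rw [← Finset.sum_add_distrib, Finset.sum_congr rfl fun v _ =>
      Nat.sub_add_cancel (h.card_vertex_le hdeg v.1)]
    simp [mul_comm]
  rw [hI, hJ] at hw
  rw [Nat.mul_sub]
  omega

end GoodSeq

open Classical in
lemma card_goodSeq_le (U : Fin x ↪ VT) (V : Fin y ↪ VT) (W : Fin z ↪ VT)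
    (hWU : ∀ m i, W m ≠ U i)
    (hcover : ∀ v : VT, (∃ i, U i = v) ∨ (∃ j, V j = v) ∨ (∃ m, W m = v))
    (H : SimpleGraph VT) [DecidableRel H.Adj]
    (hdeg : ∀ v, v ∉ Set.range U → v ∉ Set.range V → ∃ w, H.Adj v w) {q d m : ℕ}
    (hq : ∀ S : Finset VT,
      (∀ (i : Fin x) (j : Fin y) (p : H.Walk (U i) (V j)), ∃ s ∈ S, s ∈ p.support) → q ≤ S.card)
    (hd : d + k * (q - (common U V).card) = (k + 1) * Fintype.card {v // v ∉ common U V})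
    (hm : m = (k + 1) * z + k * (q - (common U V).card))
    (c : Fin n → {v // v ∉ common U V}) :
    (Finset.univ.filter fun f : (Fin (k + 1) → VT ↪ Fin n) × (Fin (k + 1) → VT ↪ Fin n) =>
      GoodSeq U V H c f.1 f.2).card ≤
      (d + m) ^ (2 * m) * n ^ d * n ^ (common U V).card := by
  let T := {v // v ∉ common U V}
  let X := (Fin (k + 1) × T) ⊕ (Fin (k + 1) × Fin z)
  have hX : Fintype.card X = d + m := by
    simp only [X, Fintype.card_sum, Fintype.card_prod, Fintype.card_fin]
    change (k + 1) * Fintype.card {v // v ∉ common U V} + _ = _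
    omega
  have hWT : ∀ l, W l ∉ common U V := by
    intro l hl
    simp only [common, Finset.mem_inter, Finset.mem_image, Finset.mem_univ, true_and] at hl
    obtain ⟨⟨i, hi⟩, -⟩ := hl
    exact hWU l i hi.symm
  let code : (Fin (k + 1) → VT ↪ Fin n) × (Fin (k + 1) → VT ↪ Fin n) →
      (X → Fin n) × (common U V → Fin n) := fun f =>
    (Sum.elim (fun a => f.1 a.1 a.2.1) (fun a => f.2 a.1 (W a.2)), fun v => f.1 0 v.1)
  calc _ ≤ ((Finset.univ.filter fun F : X → Fin n => (Finset.univ.image F).card ≤ d) ×ˢ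
        (Finset.univ : Finset (common U V → Fin n))).card := by
        refine Finset.card_le_card_of_injOn code ?_ ?_
        · rintro ⟨φ, ψ⟩ hf
          have h : GoodSeq U V H c φ ψ := by simpa using hf
          simp only [Finset.coe_product, Set.mem_prod, Finset.mem_coe, Finset.mem_filter,
            Finset.mem_univ, true_and, and_true]
          have hs := h.sum_card_le hdeg hq
          refine le_trans ?_ (show ∑ v : {v // v ∉ common U V},
            (Finset.univ.image fun a => seqMap φ ψ a v.1).card ≤ d by omega)
          refine le_trans (Finset.card_le_card ?_) Finset.card_biUnion_le
          intro b hb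
          obtain ⟨a, -, rfl⟩ := Finset.mem_image.1 hb
          rw [Finset.mem_biUnion]
          rcases a with ⟨i, v⟩ | ⟨i, l⟩
          · exact ⟨v, Finset.mem_univ _, Finset.mem_image.2 ⟨(i, false), Finset.mem_univ _, rfl⟩⟩
          · exact ⟨⟨W l, hWT l⟩, Finset.mem_univ _,
              Finset.mem_image.2 ⟨(i, true), Finset.mem_univ _, rfl⟩⟩
        · rintro ⟨φ, ψ⟩ hf ⟨φ', ψ'⟩ hf' heq
          have h : GoodSeq U V H c φ ψ := by simpa using hf
          have h' : GoodSeq U V H c φ' ψ' := by simpa using hf'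
          have e1 := congrArg Prod.fst heq
          have e2 := congrArg Prod.snd heq
          have hφ : ∀ i v, φ i v = φ' i v := by
            intro i v
            by_cases hv : v ∈ common U V
            · have h1 := h.apply_common hv (i, false)
              have h2 := h'.apply_common hv (i, false)
              have h3 : φ 0 v = φ' 0 v := congrFun e2 ⟨v, hv⟩
              exact h1.trans (h3.trans h2.symm)
            · exact congrFun e1 (Sum.inl (i, ⟨v, hv⟩))
          have hψ : ∀ i v, ψ i v = ψ' i v := by
            intro i v
            rcases hcover v with ⟨j, rfl⟩ | ⟨j, rfl⟩ | ⟨l, rfl⟩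
            · rw [h.agree_left, h'.agree_left, hφ]
            · rw [← h.agree_right, ← h'.agree_right, hφ]
            · exact congrFun e1 (Sum.inr (i, l))
          refine Prod.ext ?_ ?_
          · funext i; exact DFunLike.ext _ _ (hφ i)
          · funext i; exact DFunLike.ext _ _ (hψ i)
    _ ≤ _ := by
      rw [Finset.card_product]
      refine Nat.mul_le_mul ?_ ?_
      · simpa using card_filter_image_le (Y := Fin n) hX
      · simp

/-- The part of the edge monomial on embeddings respecting a colouring. -/
noncomputable def colouredSign (U : Fin x ↪ VT) (V : Fin y ↪ VT) (H : SimpleGraph VT)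
    [DecidableRel H.Adj] (c : Fin n → {v // v ∉ common U V}) (g : Sym2 (Fin n) → Bool)
    (φ : VT ↪ Fin n) : ℝ :=
  if ∀ v : {v // v ∉ common U V}, c (φ v.1) = v then edgeSign H g φ else 0

open Classical in
lemma sum_trace_coloured_le (U : Fin x ↪ VT) (V : Fin y ↪ VT) (H : SimpleGraph VT)
    [DecidableRel H.Adj] (c : Fin n → {v // v ∉ common U V}) :
    ∑ g : Sym2 (Fin n) → Bool,
      ((((incidence n U).transpose * Matrix.diagonal (colouredSign U V H c g) * incidence n V) *
        ((incidence n U).transpose * Matrix.diagonal (colouredSign U V H c g) *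
          incidence n V).transpose) ^ (k + 1)).trace ≤
      ((Finset.univ.filter fun f : (Fin (k + 1) → VT ↪ Fin n) × (Fin (k + 1) → VT ↪ Fin n) =>
        GoodSeq U V H c f.1 f.2).card : ℝ) * Fintype.card (Sym2 (Fin n) → Bool) := by
  simp only [trace_moment_eq_sum]
  rw [Finset.sum_comm, Finset.card_filter, Nat.cast_sum, Finset.sum_mul, Fintype.sum_prod_type]
  refine Finset.sum_le_sum fun φ _ => ?_
  rw [Finset.sum_comm]
  refine Finset.sum_le_sum fun ψ _ => ?_
  rw [← Finset.mul_sum]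
  set w := ∏ i, (incidence n V * (incidence n V).transpose) (φ i) (ψ i) *
    (incidence n U * (incidence n U).transpose) (ψ i) (φ (i + 1)) with hw
  have hw0 : 0 ≤ w := Finset.prod_nonneg fun i _ =>
    mul_nonneg (incidence_gram_nonneg _ _ _) (incidence_gram_nonneg _ _ _)
  have hw1 : w ≤ 1 := Finset.prod_le_one
    (fun i _ => mul_nonneg (incidence_gram_nonneg _ _ _) (incidence_gram_nonneg _ _ _))
    (fun i _ => mul_le_one₀ (incidence_gram_le_one _ _ _) (incidence_gram_nonneg _ _ _)
      (incidence_gram_le_one _ _ _))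
  have hprod : ∀ g : Sym2 (Fin n) → Bool, ∏ i, edgeSign H g (φ i) * edgeSign H g (ψ i) =
      ∏ a ∈ (Finset.univ ×ˢ H.edgeFinset : Finset ((Fin (k + 1) × Bool) × Sym2 VT)),
        sgn (g (Sym2.map (seqMap φ ψ a.1) a.2)) := by
    intro g
    rw [Finset.prod_product, Fintype.prod_prod_type]
    refine Finset.prod_congr rfl fun i _ => ?_
    rw [Fintype.prod_bool, mul_comm]
    rfl
  have hzero : w = 0 ∨ ∑ g : Sym2 (Fin n) → Bool,
      ∏ i, colouredSign U V H c g (φ i) * colouredSign U V H c g (ψ i) = 0 →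
      w * ∑ g : Sym2 (Fin n) → Bool,
        ∏ i, colouredSign U V H c g (φ i) * colouredSign U V H c g (ψ i) ≤
      ((if GoodSeq U V H c φ ψ then 1 else 0 : ℕ) : ℝ) *
        Fintype.card (Sym2 (Fin n) → Bool) := by
    intro h
    rw [show w * _ = 0 from mul_eq_zero.2 h]
    positivity
  by_cases hcl : ∀ i (v : {v // v ∉ common U V}), c (φ i v.1) = v
  swap
  · refine hzero (Or.inr (Finset.sum_eq_zero fun g _ => ?_))
    obtain ⟨i, hi⟩ := not_forall.1 hcl
    exact Finset.prod_eq_zero (Finset.mem_univ i) (by simp only [colouredSign, if_neg hi, zero_mul])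
  by_cases hcr : ∀ i (v : {v // v ∉ common U V}), c (ψ i v.1) = v
  swap
  · refine hzero (Or.inr (Finset.sum_eq_zero fun g _ => ?_))
    obtain ⟨i, hi⟩ := not_forall.1 hcr
    exact Finset.prod_eq_zero (Finset.mem_univ i) (by simp only [colouredSign, if_neg hi, mul_zero])
  have hcol : ∀ g : Sym2 (Fin n) → Bool,
      ∏ i, colouredSign U V H c g (φ i) * colouredSign U V H c g (ψ i) =
        ∏ a ∈ (Finset.univ ×ˢ H.edgeFinset : Finset ((Fin (k + 1) × Bool) × Sym2 VT)),
          sgn (g (Sym2.map (seqMap φ ψ a.1) a.2)) := by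
    intro g
    rw [← hprod]
    refine Finset.prod_congr rfl fun i _ => ?_
    rw [colouredSign, colouredSign, if_pos (hcl i), if_pos (hcr i)]
  by_cases har : ∀ i j, φ i (V j) = ψ i (V j)
  swap
  · obtain ⟨i, hi⟩ := not_forall.1 har
    exact hzero (Or.inl (Finset.prod_eq_zero (Finset.mem_univ i)
      (by rw [incidence_gram_eq_zero V hi, zero_mul])))
  by_cases hal : ∀ i j, ψ i (U j) = φ (i + 1) (U j)
  swap
  · obtain ⟨i, hi⟩ := not_forall.1 hal
    exact hzero (Or.inl (Finset.prod_eq_zero (Finset.mem_univ i)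
      (by rw [incidence_gram_eq_zero U hi, mul_zero])))
  by_cases hev : ∀ s : Sym2 (Fin n), Even ((Finset.univ ×ˢ H.edgeFinset).filter
    fun a : (Fin (k + 1) × Bool) × Sym2 VT => Sym2.map (seqMap φ ψ a.1) a.2 = s).card
  swap
  · obtain ⟨s, hs⟩ := not_forall.1 hev
    refine hzero (Or.inr ?_)
    simp only [hcol]
    exact sum_prod_sgn_eq_zero _ _ (Nat.not_even_iff_odd.1 hs)
  rw [if_pos ⟨hcl, hcr, har, hal, hev⟩, Nat.cast_one, one_mul]
  simp only [hcol]
  refine le_trans (mul_le_mul_of_nonneg_left (sum_prod_sgn_le _ _) hw0) ?_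
  exact mul_le_of_le_one_left (Nat.cast_nonneg _) hw1

end GoodSequences

section NormBound

open scoped Matrix.Norms.L2Operator in
lemma opNorm_sum_le {α β ι : Type*} [Fintype α] [Fintype β] [DecidableEq β] (s : Finset ι)
    (M : ι → Matrix α β ℝ) : opNorm (∑ i ∈ s, M i) ≤ ∑ i ∈ s, opNorm (M i) :=
  norm_sum_le s M

open scoped Matrix.Norms.L2Operator in
lemma opNorm_smul {α β : Type*} [Fintype α] [Fintype β] [DecidableEq β] (a : ℝ)
    (M : Matrix α β ℝ) : opNorm (a • M) = |a| * opNorm M :=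
  norm_smul a M

lemma Pr_le_of_sum_pow_le {n m : ℕ} {f : (Sym2 (Fin n) → Bool) → ℝ} {a ε : ℝ} (ha : 0 < a)
    (hf : ∀ g, 0 ≤ f g)
    (h : ∑ g, f g ^ m ≤ Fintype.card (Sym2 (Fin n) → Bool) * (ε * a ^ m)) :
    Pr (fun g => a ≤ f g) ≤ ε := by
  classical
  unfold Pr
  have hG : (0 : ℝ) < Fintype.card (Sym2 (Fin n) → Bool) := Nat.cast_pos.2 Fintype.card_pos
  rw [div_le_iff₀ hG]
  have hle : ((Finset.univ.filter fun g => a ≤ f g).card : ℝ) * a ^ m ≤ ∑ g, f g ^ m := by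
    rw [← nsmul_eq_mul]
    refine (Finset.card_nsmul_le_sum _ (fun g => f g ^ m) _ fun g hg => ?_).trans
      (Finset.sum_le_sum_of_subset_of_nonneg (Finset.subset_univ _)
        fun g _ _ => pow_nonneg (hf g) m)
    exact pow_le_pow_left₀ ha.le (Finset.mem_filter.1 hg).2 m
  refine le_of_mul_le_mul_right ?_ (pow_pos ha m)
  calc _ ≤ _ := by convert hle
    _ ≤ _ := h
    _ = _ := by ring

variable {n x y z k : ℕ} {VT : Type*} [Fintype VT] [DecidableEq VT]

lemma sum_colouredSign (U : Fin x ↪ VT) (V : Fin y ↪ VT) (H : SimpleGraph VT)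
    [DecidableRel H.Adj] (g : Sym2 (Fin n) → Bool) (φ : VT ↪ Fin n) :
    ((Fintype.card {v // v ∉ common U V} : ℝ) ^ Fintype.card {v // v ∉ common U V}) *
        ∑ c : Fin n → {v // v ∉ common U V}, colouredSign U V H c g φ =
      Fintype.card (Fin n → {v // v ∉ common U V}) * edgeSign H g φ := by
  have h := card_inverting_colourings (fun v : {v // v ∉ common U V} => φ v.1)
    fun v w hvw => Subtype.ext (φ.injective hvw)
  rw [← h]
  simp only [colouredSign, ← Finset.sum_filter, Finset.sum_const, nsmul_eq_mul]
  push_cast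
  ring

lemma opNorm_pow_le_sum_coloured (U : Fin x ↪ VT) (V : Fin y ↪ VT) (H : SimpleGraph VT)
    [DecidableRel H.Adj] [Nonempty {v // v ∉ common U V}] (g : Sym2 (Fin n) → Bool) :
    (Fintype.card (Fin n → {v // v ∉ common U V}) : ℝ) *
      opNorm ((incidence n U).transpose * Matrix.diagonal (edgeSign H g) * incidence n V) ^
        (2 * (k + 1)) ≤
      ((Fintype.card {v // v ∉ common U V} : ℝ) ^ Fintype.card {v // v ∉ common U V}) ^
        (2 * (k + 1)) *
      ∑ c : Fin n → {v // v ∉ common U V}, opNorm ((incidence n U).transpose *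
        Matrix.diagonal (colouredSign U V H c g) * incidence n V) ^ (2 * (k + 1)) := by
  set s : ℝ := (Fintype.card {v // v ∉ common U V} : ℝ) ^ Fintype.card {v // v ∉ common U V}
    with hs
  have hs0 : 0 ≤ s := by positivity
  set N := (Fintype.card (Fin n → {v // v ∉ common U V}) : ℝ) with hN
  have hN0 : 0 < N := Nat.cast_pos.2 Fintype.card_pos
  set R := (incidence n U).transpose * Matrix.diagonal (edgeSign H g) * incidence n V with hR
  set Rc := fun c : Fin n → {v // v ∉ common U V} => (incidence n U).transpose *
        Matrix.diagonal (colouredSign U V H c g) * incidence n V with hRc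
  have hsum : N • R = s • ∑ c, Rc c := by
    have hdiag : s • ∑ c : Fin n → {v // v ∉ common U V},
        Matrix.diagonal (colouredSign U V H c g) = N • Matrix.diagonal (edgeSign H g) := by
      ext φ ψ
      by_cases h : φ = ψ
      · subst h
        simp only [Matrix.smul_apply, Matrix.sum_apply, Matrix.diagonal_apply_eq, smul_eq_mul]
        exact sum_colouredSign U V H g φ
      · simp [Matrix.sum_apply, Matrix.diagonal_apply_ne _ h]
    simp only [hR, hRc]
    rw [← Matrix.sum_mul, ← Matrix.mul_sum, ← Matrix.smul_mul, ← Matrix.mul_smul,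
      ← Matrix.smul_mul, ← Matrix.mul_smul, hdiag]
  have hnorm : N * opNorm R ≤ s * ∑ c, opNorm (Rc c) := by
    have h := congrArg opNorm hsum
    rw [opNorm_smul, opNorm_smul, abs_of_pos hN0, abs_of_nonneg hs0] at h
    rw [h]
    exact mul_le_mul_of_nonneg_left (opNorm_sum_le _ _) hs0
  have hjensen := pow_sum_div_card_le_sum_pow (s := Finset.univ) (n := 2 * k + 1)
    (f := fun c => opNorm (Rc c)) fun c _ => opNorm_nonneg _
  rw [Finset.card_univ, ← hN, div_le_iff₀ (by positivity)] at hjensen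
  have hpow := pow_le_pow_left₀ (mul_nonneg hN0.le (opNorm_nonneg R)) hnorm (2 * (k + 1))
  rw [mul_pow, mul_pow] at hpow
  have h2 : 2 * k + 1 + 1 = 2 * (k + 1) := by ring
  rw [h2] at hjensen
  refine le_of_mul_le_mul_left ?_ (pow_pos hN0 (2 * k + 1))
  calc _ = N ^ (2 * (k + 1)) * opNorm R ^ (2 * (k + 1)) := by rw [← h2, pow_succ N]; ring
    _ ≤ _ := hpow
    _ ≤ _ := mul_le_mul_of_nonneg_left hjensen (by positivity)
    _ = _ := by ring

lemma sum_opNorm_pow_le (U : Fin x ↪ VT) (V : Fin y ↪ VT) (W : Fin z ↪ VT)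
    (hWU : ∀ m i, W m ≠ U i)
    (hcover : ∀ v : VT, (∃ i, U i = v) ∨ (∃ j, V j = v) ∨ (∃ m, W m = v))
    (H : SimpleGraph VT) [DecidableRel H.Adj]
    (hdeg : ∀ v, v ∉ Set.range U → v ∉ Set.range V → ∃ w, H.Adj v w) {q d m : ℕ}
    (hq : ∀ S : Finset VT,
      (∀ (i : Fin x) (j : Fin y) (p : H.Walk (U i) (V j)), ∃ s ∈ S, s ∈ p.support) → q ≤ S.card)
    (hd : d + k * (q - (common U V).card) = (k + 1) * Fintype.card {v // v ∉ common U V})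
    (hm : m = (k + 1) * z + k * (q - (common U V).card))
    [Nonempty {v // v ∉ common U V}] :
    ∑ g : Sym2 (Fin n) → Bool,
      opNorm ((incidence n U).transpose * Matrix.diagonal (edgeSign H g) * incidence n V) ^
        (2 * (k + 1)) ≤
      Fintype.card (Sym2 (Fin n) → Bool) *
        (((Fintype.card {v // v ∉ common U V} : ℝ) ^ Fintype.card {v // v ∉ common U V}) ^
          (2 * (k + 1)) * (((d + m : ℕ) : ℝ) ^ (2 * m) * n ^ d * n ^ (common U V).card)) := by
  classical
  have hN0 : (0 : ℝ) < Fintype.card (Fin n → {v // v ∉ common U V}) :=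
    Nat.cast_pos.2 Fintype.card_pos
  refine le_of_mul_le_mul_left ?_ hN0
  rw [Finset.mul_sum]
  refine (Finset.sum_le_sum fun g _ => opNorm_pow_le_sum_coloured U V H g).trans ?_
  rw [← Finset.mul_sum, Finset.sum_comm]
  have hc : ∀ c : Fin n → {v // v ∉ common U V},
      ∑ g : Sym2 (Fin n) → Bool, opNorm ((incidence n U).transpose *
        Matrix.diagonal (colouredSign U V H c g) * incidence n V) ^ (2 * (k + 1)) ≤
      (((d + m : ℕ) : ℝ) ^ (2 * m) * n ^ d * n ^ (common U V).card) *
        Fintype.card (Sym2 (Fin n) → Bool) := by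
    intro c
    refine (Finset.sum_le_sum fun g _ => opNorm_pow_le_trace _ k.succ_ne_zero).trans
      ((sum_trace_coloured_le U V H c).trans (mul_le_mul_of_nonneg_right ?_ (Nat.cast_nonneg _)))
    exact_mod_cast card_goodSeq_le U V W hWU hcover H hdeg hq hd hm c
  refine (mul_le_mul_of_nonneg_left (Finset.sum_le_card_nsmul _ _ _ fun c _ => hc c)
    (by positivity)).trans (le_of_eq ?_)
  rw [Finset.card_univ, nsmul_eq_mul]
  ring

/-- The choice of the moment order: the moment bound is at most `ε` times the corresponding power
of the threshold. -/
lemma exists_moment_order {s z Q r n : ℕ} {ε : ℝ} (hn : 1 ≤ n) (hs : 1 ≤ s) (hQ : Q ≤ s)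
    (hQz : 1 ≤ Q + z) (hε : 0 < ε) (hε1 : ε < 1) :
    ∃ k d m : ℕ, d + k * Q = (k + 1) * s ∧ m = (k + 1) * z + k * Q ∧
      ((s : ℝ) ^ s) ^ (2 * (k + 1)) * (((d + m : ℕ) : ℝ) ^ (2 * m) * n ^ d * n ^ r) ≤
      ε * (2 * (s : ℝ) ^ s * (Real.exp 1 * ((s + z : ℕ) : ℝ) *
        (Real.log (8 * (n : ℝ) ^ (Q + r) / ε) / (2 * ((Q + z : ℕ) : ℝ)) + 1)) ^ (Q + z) *
        (n : ℝ) ^ (((s : ℝ) - (Q : ℝ)) / 2)) ^ (2 * (k + 1)) := by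
  have hn1 : (1 : ℝ) ≤ n := by exact_mod_cast hn
  have hP : (1 : ℝ) ≤ (n : ℝ) ^ (Q + r) := one_le_pow₀ hn1
  set L := Real.log (8 * (n : ℝ) ^ (Q + r) / ε) with hL
  have harg : 1 < 8 * (n : ℝ) ^ (Q + r) / ε := by
    rw [lt_div_iff₀ hε]
    linarith
  have hLpos : 0 < L := Real.log_pos harg
  have hQz' : (0 : ℝ) < 2 * ((Q + z : ℕ) : ℝ) := by
    have : (1 : ℝ) ≤ ((Q + z : ℕ) : ℝ) := by exact_mod_cast hQz
    linarith
  set X := L / (2 * ((Q + z : ℕ) : ℝ)) with hX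
  have hXpos : 0 < X := div_pos hLpos hQz'
  obtain ⟨k, hk⟩ := Nat.exists_eq_succ_of_ne_zero (Nat.ceil_pos.2 hXpos).ne'
  have hkX : X ≤ ((k + 1 : ℕ) : ℝ) := by
    have := Nat.le_ceil X
    rwa [hk] at this
  have hkX1 : ((k + 1 : ℕ) : ℝ) ≤ X + 1 := by
    have := (Nat.ceil_lt_add_one hXpos.le).le
    rwa [hk] at this
  obtain ⟨p, rfl⟩ := Nat.exists_eq_add_of_le hQ
  refine ⟨k, (k + 1) * p + Q, (k + 1) * z + k * Q, by ring, rfl, ?_⟩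
  set S : ℝ := ((Q + p : ℕ) : ℝ) ^ (Q + p) with hS
  set A : ℝ := ((Q + p + z : ℕ) : ℝ) with hA
  set K : ℝ := ((k + 1 : ℕ) : ℝ) with hK
  have hA1 : 1 ≤ A := by rw [hA]; exact_mod_cast (by omega : 1 ≤ Q + p + z)
  have hK1 : 1 ≤ K := by rw [hK]; exact_mod_cast (by omega : 1 ≤ k + 1)
  have hdm : ((((k + 1) * p + Q + ((k + 1) * z + k * Q) : ℕ)) : ℝ) = A * K := by
    rw [hA, hK]; push_cast; ring
  have hexp : 8 * (n : ℝ) ^ (Q + r) / ε ≤ Real.exp 1 ^ (2 * (k + 1) * (Q + z)) := by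
    rw [← Real.exp_nat_mul, mul_one, ← Real.log_le_iff_le_exp (by linarith), ← hL]
    rw [hX, div_le_iff₀ hQz'] at hkX
    refine hkX.trans (le_of_eq ?_)
    rw [hK]; push_cast; ring
  rw [div_le_iff₀ hε] at hexp
  have hnp : ((n : ℝ) ^ ((((Q + p : ℕ) : ℝ) - (Q : ℝ)) / 2)) ^ (2 * (k + 1)) =
      (n : ℝ) ^ ((k + 1) * p) := by
    rw [← Real.rpow_natCast, ← Real.rpow_mul (by linarith), ← Real.rpow_natCast]
    congr 1
    push_cast
    ring
  rw [hdm, mul_pow _ ((n : ℝ) ^ _), hnp, mul_pow (2 * S), mul_pow 2 S,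
    ← pow_mul (Real.exp 1 * A * (X + 1)), mul_comm (Q + z), mul_pow _ (X + 1), mul_pow _ A]
  have hAK : (A * K) ^ (2 * ((k + 1) * z + k * Q)) ≤ (A * K) ^ (2 * (k + 1) * (Q + z)) :=
    pow_le_pow_right₀ (one_le_mul_of_one_le_of_one_le hA1 hK1) (by nlinarith)
  have hKX : (A * K) ^ (2 * (k + 1) * (Q + z)) ≤
      A ^ (2 * (k + 1) * (Q + z)) * (X + 1) ^ (2 * (k + 1) * (Q + z)) := by
    rw [mul_pow]
    gcongr
  have hS0 : 0 ≤ S := by positivity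
  have h2 : (1 : ℝ) ≤ 2 ^ (2 * (k + 1)) := one_le_pow₀ one_le_two
  have hn8 : (n : ℝ) ^ (Q + r) ≤ Real.exp 1 ^ (2 * (k + 1) * (Q + z)) * ε := by linarith
  calc S ^ (2 * (k + 1)) *
        ((A * K) ^ (2 * ((k + 1) * z + k * Q)) * n ^ ((k + 1) * p + Q) * n ^ r)
      = S ^ (2 * (k + 1)) * (n : ℝ) ^ ((k + 1) * p) *
          ((A * K) ^ (2 * ((k + 1) * z + k * Q)) * (n : ℝ) ^ (Q + r)) := by
        rw [pow_add, pow_add]; ring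
    _ ≤ S ^ (2 * (k + 1)) * (n : ℝ) ^ ((k + 1) * p) *
          ((A ^ (2 * (k + 1) * (Q + z)) * (X + 1) ^ (2 * (k + 1) * (Q + z))) *
            (Real.exp 1 ^ (2 * (k + 1) * (Q + z)) * ε)) := by
        gcongr
        exact hAK.trans hKX
    _ ≤ 2 ^ (2 * (k + 1)) * (S ^ (2 * (k + 1)) * (n : ℝ) ^ ((k + 1) * p) *
          ((A ^ (2 * (k + 1) * (Q + z)) * (X + 1) ^ (2 * (k + 1) * (Q + z))) *
            (Real.exp 1 ^ (2 * (k + 1) * (Q + z)) * ε))) :=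
        le_mul_of_one_le_left (by positivity) h2
    _ = _ := by ring

lemma abs_edgeSign (H : SimpleGraph VT) [DecidableRel H.Adj] (g : Sym2 (Fin n) → Bool)
    (φ : VT ↪ Fin n) : |edgeSign H g φ| = 1 := by
  rw [edgeSign, Finset.abs_prod]
  exact Finset.prod_eq_one fun e _ => abs_sgn _

/-- The norm bound in the absence of vertices outside `U` and `V`. -/
lemma opNorm_sq_le_card (U : Fin x ↪ VT) (V : Fin y ↪ VT)
    (hcover : ∀ v : VT, (∃ i, U i = v) ∨ (∃ j, V j = v))
    (H : SimpleGraph VT) [DecidableRel H.Adj] (g : Sym2 (Fin n) → Bool) :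
    opNorm ((incidence n U).transpose * Matrix.diagonal (edgeSign H g) * incidence n V) ^ 2 ≤
      (n : ℝ) ^ Fintype.card VT := by
  classical
  have h := opNorm_pow_le_trace ((incidence n U).transpose * Matrix.diagonal (edgeSign H g) *
    incidence n V) (k := 0 + 1) one_ne_zero
  rw [trace_moment_eq_sum] at h
  have hterm : ∀ φ ψ : Fin (0 + 1) → VT ↪ Fin n,
      (∏ i, (incidence n V * (incidence n V).transpose) (φ i) (ψ i) *
        (incidence n U * (incidence n U).transpose) (ψ i) (φ (i + 1))) *
        ∏ i, edgeSign H g (φ i) * edgeSign H g (ψ i) ≤ if φ = ψ then 1 else 0 := by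
    intro φ ψ
    rw [Fin.prod_univ_one, Fin.prod_univ_one, show (0 + 1 : Fin (0 + 1)) = 0 from rfl]
    by_cases hV : ∀ j, φ 0 (V j) = ψ 0 (V j)
    swap
    · rw [incidence_gram_eq_zero V hV]
      split_ifs <;> simp
    by_cases hU : ∀ i, ψ 0 (U i) = φ 0 (U i)
    swap
    · rw [incidence_gram_eq_zero U hU]
      split_ifs <;> simp
    have hφψ : φ = ψ := by
      funext i
      rw [show i = 0 from Fin.ext (by omega)]
      ext v
      rcases hcover v with ⟨i, rfl⟩ | ⟨j, rfl⟩
      · rw [hU]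
      · rw [hV]
    rw [if_pos hφψ]
    refine (le_abs_self _).trans ?_
    rw [abs_mul, abs_mul (edgeSign H g _), abs_edgeSign, abs_edgeSign, mul_one, mul_one,
      abs_of_nonneg (mul_nonneg (incidence_gram_nonneg _ _ _) (incidence_gram_nonneg _ _ _))]
    exact mul_le_one₀ (incidence_gram_le_one _ _ _) (incidence_gram_nonneg _ _ _)
      (incidence_gram_le_one _ _ _)
  refine h.trans ((Finset.sum_le_sum fun φ _ => Finset.sum_le_sum fun ψ _ => hterm φ ψ).trans ?_)
  simp only [Finset.sum_ite_eq, Finset.mem_univ, if_true, Finset.sum_const, Finset.card_univ,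
    nsmul_eq_mul, mul_one]
  have : Fintype.card (Fin (0 + 1) → VT ↪ Fin n) ≤ n ^ Fintype.card VT := by
    simpa [Fintype.card_embedding_eq] using Nat.descFactorial_le_pow n (Fintype.card VT)
  exact_mod_cast this

end NormBound

theorem stmt19 (n x y z r q t : ℕ) [NeZero n]
    {VT : Type*} [Fintype VT] [DecidableEq VT]
    (U : Fin x ↪ VT) (V : Fin y ↪ VT) (W : Fin z ↪ VT)
    (hWU : ∀ m i, W m ≠ U i) (hWV : ∀ m j, W m ≠ V j)
    (hcover : ∀ v : VT, (∃ i, U i = v) ∨ (∃ j, V j = v) ∨ (∃ m, W m = v))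
    (H : SimpleGraph VT) [DecidableRel H.Adj]
    (hdeg : ∀ m : Fin z, 0 < H.degree (W m))
    (ht : Fintype.card VT = t)
    (hr : ((Finset.univ.image ⇑U) ∩ (Finset.univ.image ⇑V)).card = r)
    (hq : IsLeast {m | ∃ S : Finset VT,
        (∀ (i : Fin x) (j : Fin y) (p : H.Walk (U i) (V j)), ∃ s ∈ S, s ∈ p.support) ∧
        S.card = m} q) :
    (1 ≤ (q - r) + z → ∀ ε : ℝ, 0 < ε → ε < 1 →
      Pr (fun g : Sym2 (Fin n) → Bool =>
          2 * ((t - r : ℕ) : ℝ) ^ (t - r) *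
              (Real.exp 1 * (((t - r) + z : ℕ) : ℝ) *
                (Real.log (8 * (n : ℝ) ^ ((q - r) + r) / ε) /
                    (2 * (((q - r) + z : ℕ) : ℝ)) + 1)) ^ ((q - r) + z) *
              (n : ℝ) ^ ((((t - r : ℕ) : ℝ) - ((q - r : ℕ) : ℝ)) / 2)
            ≤ opNorm (RH19 U V W H g)) ≤ ε) ∧
    (q - r = 0 → z = 0 → ∀ g : Sym2 (Fin n) → Bool,
      opNorm (RH19 U V W H g) ≤ (n : ℝ) ^ ((t : ℝ) / 2)) := by
  simp only [RH19_eq_mul U V W hWU hWV hcover]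
  have hn : 1 ≤ n := NeZero.one_le
  refine ⟨fun hqz ε hε hε1 => ?_, fun _ hz g => ?_⟩
  · have hr' : (common U V).card = r := hr
    have hT : Fintype.card {v // v ∉ common U V} = t - r := by
      rw [Fintype.card_subtype_compl, Fintype.card_coe, ht, hr']
    have hsep : ∀ S : Finset VT, (∀ (i : Fin x) (j : Fin y) (p : H.Walk (U i) (V j)),
        ∃ s ∈ S, s ∈ p.support) → q ≤ S.card := fun S hS => hq.2 ⟨S, hS, rfl⟩
    have hqt : q ≤ t := by
      rw [← ht]
      exact hsep Finset.univ fun i j p => ⟨_, Finset.mem_univ _, p.start_mem_support⟩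
    have hdeg' : ∀ v, v ∉ Set.range U → v ∉ Set.range V → ∃ w, H.Adj v w := by
      intro v hU hV
      rcases hcover v with h | h | ⟨m, rfl⟩
      · exact (hU h).elim
      · exact (hV h).elim
      · exact (H.degree_pos_iff_exists_adj _).1 (hdeg m)
    have hts : 1 ≤ t - r := by
      by_contra hlt
      have hz : 0 < z := by omega
      have : W ⟨0, hz⟩ ∈ common U V := by
        by_contra hmem
        have := Fintype.card_pos_iff.2 ⟨(⟨W ⟨0, hz⟩, hmem⟩ : {v // v ∉ common U V})⟩
        omega
      obtain ⟨i, -, hi⟩ := Finset.mem_image.1 (Finset.mem_inter.1 this).1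
      exact hWU _ i hi.symm
    have : Nonempty {v // v ∉ common U V} := Fintype.card_pos_iff.1 (by omega)
    obtain ⟨k, d, m, hd, hm, hle⟩ := exists_moment_order (s := t - r) (z := z) (Q := q - r)
      (r := r) hn hts (by omega) hqz hε hε1
    have hmom := sum_opNorm_pow_le (n := n) U V W hWU hcover H hdeg' hsep
      (d := d) (m := m) (k := k) (by rw [hT, hr', hd]) (by rw [hr', hm])
    rw [hT, hr'] at hmom
    refine Pr_le_of_sum_pow_le ?_ (fun g => opNorm_nonneg _)
      (hmom.trans (mul_le_mul_of_nonneg_left hle (Nat.cast_nonneg _)))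
    have hn1 : (1 : ℝ) ≤ n := by exact_mod_cast hn
    have hlog : 0 ≤ Real.log (8 * (n : ℝ) ^ ((q - r) + r) / ε) := by
      refine Real.log_nonneg ?_
      rw [le_div_iff₀ hε]
      have : (1 : ℝ) ≤ (n : ℝ) ^ ((q - r) + r) := one_le_pow₀ hn1
      linarith
    have hts0 : (0 : ℝ) < ((t - r : ℕ) : ℝ) := by exact_mod_cast hts
    have htz0 : (0 : ℝ) < (((t - r) + z : ℕ) : ℝ) := by
      exact_mod_cast (by omega : 0 < (t - r) + z)
    positivity
  · subst hz
    have h := opNorm_sq_le_card U V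
      (fun v => (hcover v).imp_right fun h => h.elim id fun ⟨m, _⟩ => m.elim0) H g
    rw [ht] at h
    refine (Real.le_sqrt_of_sq_le h).trans (le_of_eq ?_)
    rw [Real.sqrt_eq_rpow, ← Real.rpow_natCast, ← Real.rpow_mul (Nat.cast_nonneg n)]
    congr 1
    ring
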